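/- Let φ : X → ℝ be a normalized potential with summable variation of the form φ = u − u∘θ − log|A| for some continuous function u : X → ℝ (so its equilibrium state μ_φ is the measure of maximal entropy). Then for every q ∈ ℝ the limit R_{μ_φ}(q) = lim_n (1/n) log ∫ R_n^q dμ_φ exists, and R_{μ_φ}(q) = q log|A| for q ≥ −1 while R_{μ_φ}(q) = −log|A| for q < −1. -/

import Mathlib

open MeasureTheory Filter Topology Set

namespace RTSpec

variable (A : Type*) [Fintype A] [TopologicalSpace A] [DiscreteTopology A]
  [MeasurableSpace A] [BorelSpace A]

/-- The sequence space `X = A^ℕ` (0-indexed: `x 0` is the paper's `x₁`). -/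
abbrev X := ℕ → A

/-- The shift map `θ`. -/
def shift : X A → X A := fun x n => x (n + 1)

/-- The cylinder `[a_1^n]` based on the word `w = a_1^n`. -/
def cyl {n : ℕ} (w : Fin n → A) : Set (X A) := {x | ∀ i : Fin n, x i.val = w i}

/-- Return time `R_n(x) = inf {k ≥ 2 : x_k^{k+n-1} = x_1^n}` (with `sInf ∅ = 0`). -/
noncomputable def retTime (n : ℕ) (x : X A) : ℕ := sInf {k | 2 ≤ k ∧ ∀ i < n, x (k - 1 + i) = x i}

/-- Hitting time `T_{a_1^n}(y) = inf {k ≥ 1 : y_k^{k+n-1} = a_1^n}`. -/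
noncomputable def hitTime {n : ℕ} (w : Fin n → A) (y : X A) : ℕ :=
  sInf {k | 1 ≤ k ∧ ∀ i : Fin n, y (k - 1 + i.val) = w i}

/-- Hitting/return time in the shifted sense: `inf {k ≥ 1 : θ^k y ∈ [a_1^n]}`. -/
noncomputable def hitTime' {n : ℕ} (w : Fin n → A) (y : X A) : ℕ :=
  sInf {k | 1 ≤ k ∧ ∀ i : Fin n, y (k + i.val) = w i}

/-- `τ(a_1^n) = inf {k ≥ 1 : [a_1^n] ∩ θ^{-k}[a_1^n] ≠ ∅}`, the smallest return time
of the cylinder `[a_1^n]`. -/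
noncomputable def tau {n : ℕ} (w : Fin n → A) : ℕ :=
  sInf {k | 1 ≤ k ∧ (cyl A w ∩ {y | ∀ i : Fin n, y (k + i.val) = w i}).Nonempty}

/-- `ζ_μ(a_1^n) = μ([a_1^n] ∩ {T_{a_1^n} ≠ τ(a_1^n)}) / μ([a_1^n])`. -/
noncomputable def zeta (μ : Measure (X A)) {n : ℕ} (w : Fin n → A) : ℝ :=
  (μ (cyl A w ∩ {y | hitTime' A w y ≠ tau A w})).toReal / (μ (cyl A w)).toReal

/-- A shift-invariant Borel probability measure. -/
def InvProb (η : Measure (X A)) : Prop :=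
  IsProbabilityMeasure η ∧ Measure.map (shift A) η = η

/-- The `n`-th term `-(1/n) Σ_{a_1^n} μ(a_1^n) log μ(a_1^n)` of the entropy sequence. -/
noncomputable def entSeq (μ : Measure (X A)) (n : ℕ) : ℝ :=
  -(1 / (n : ℝ)) * ∑ w : Fin n → A, (μ (cyl A w)).toReal * Real.log (μ (cyl A w)).toReal

/-- The entropy `h(μ)`, i.e. the limit of `entSeq` (which always exists for a
shift-invariant measure; we realize it as a liminf). -/
noncomputable def entropy (μ : Measure (X A)) : ℝ := atTop.liminf (entSeq A μ)

/-- Topological pressure `P(ψ) = sup_η {h(η) + ∫ ψ dη}`, the supremum running over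
all shift-invariant probability measures. -/
noncomputable def pressure (ψ : X A → ℝ) : ℝ :=
  sSup {r | ∃ η : Measure (X A), InvProb A η ∧ r = entropy A η + ∫ x, ψ x ∂η}

/-- `sup_η ∫ φ dη` over shift-invariant probability measures. -/
noncomputable def supInt (φ : X A → ℝ) : ℝ :=
  sSup {r | ∃ η : Measure (X A), InvProb A η ∧ r = ∫ x, φ x ∂η}

/-- `inf_η ∫ φ dη` over shift-invariant probability measures. -/
noncomputable def infInt (φ : X A → ℝ) : ℝ :=
  sInf {r | ∃ η : Measure (X A), InvProb A η ∧ r = ∫ x, φ x ∂η}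

/-- `var_n(φ) = sup {|φ(x) - φ(y)| : x_1^n = y_1^n}`. -/
noncomputable def Var (φ : X A → ℝ) (n : ℕ) : ℝ :=
  sSup {r | ∃ x y : X A, (∀ i < n, x i = y i) ∧ r = |φ x - φ y|}

/-- Prepending a symbol: `ax = (a, x_1, x_2, …)`. -/
def prepend (a : A) (x : X A) : X A := fun n => Nat.casesOn n a x

/-- A potential `φ` is normalized if `Σ_{a ∈ A} e^{φ(ax)} = 1` for all `x`. -/
def Normalized (φ : X A → ℝ) : Prop :=
  ∀ x : X A, ∑ a : A, Real.exp (φ (prepend A a x)) = 1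

/-- `μ` is an equilibrium state for `φ`: a probability measure fixed by the dual
transfer operator, i.e. `∫ L_φ f dμ = ∫ f dμ` for every continuous `f`. -/
def IsEqSt (φ : X A → ℝ) (μ : Measure (X A)) : Prop :=
  IsProbabilityMeasure μ ∧ ∀ f : X A → ℝ, Continuous f →
    ∫ x, (∑ a : A, Real.exp (φ (prepend A a x)) * f (prepend A a x)) ∂μ = ∫ x, f x ∂μ

/-- The `n`-th term `(1/n) log ∫ R_n^q dμ` of the return-time `L^q`-spectrum,
with values in `EReal` (the integral may be infinite). -/
noncomputable def RSeq (μ : Measure (X A)) (q : ℝ) (n : ℕ) : EReal :=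
  (((n : ℝ)⁻¹ : ℝ) : EReal) *
    ENNReal.log (∫⁻ x, ENNReal.ofReal ((retTime A n x : ℝ) ^ q) ∂μ)

/-- The `n`-th term `(1/n) log Σ_{a_1^n} μ(a_1^n)^{1-q}` of the `L^q`-spectrum of `μ`. -/
noncomputable def MSeq (μ : Measure (X A)) (q : ℝ) (n : ℕ) : ℝ :=
  (1 / (n : ℝ)) * Real.log (∑ w : Fin n → A, (μ (cyl A w)).toReal ^ (1 - q))

/-- `Λ^{(n)}(μ) = (1/n) log Σ_{a_1^n} (1 - ζ_μ(a_1^n)) μ(a_1^n)`. -/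
noncomputable def LamSeq (μ : Measure (X A)) (n : ℕ) : ℝ :=
  (1 / (n : ℝ)) * Real.log (∑ w : Fin n → A, (1 - zeta A μ w) * (μ (cyl A w)).toReal)

/-- `(1/n) log max_{a_1^n} μ(a_1^n)`. -/
noncomputable def gammaSeq (μ : Measure (X A)) (n : ℕ) : ℝ :=
  (1 / (n : ℝ)) * Real.log (⨆ w : Fin n → A, (μ (cyl A w)).toReal)

/-- `μ` is φ-mixing with rate `ϕ`: `ϕ` decreases to `0` and for all `n, ℓ ≥ 1`,
all `S` in the σ-algebra generated by coordinates `1, …, n` with `μ S ≠ 0`, and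
all `T` in the σ-algebra generated by coordinates `n+ℓ, n+ℓ+1, …`,
`|μ(S ∩ T)/μ(S) - μ(T)| ≤ ϕ(ℓ)`. -/
def PhiMixing (μ : Measure (X A)) (ϕ : ℕ → ℝ) : Prop :=
  (∀ ℓ, 0 < ϕ ℓ) ∧ Antitone ϕ ∧ Tendsto ϕ atTop (nhds 0) ∧
  ∀ n ℓ : ℕ, 1 ≤ n → 1 ≤ ℓ →
    ∀ S T : Set (X A),
      MeasurableSet[MeasurableSpace.comap
        (fun x : X A => fun i : Fin n => x i.val) inferInstance] S →
      MeasurableSet[MeasurableSpace.comap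
        (fun x : X A => fun j : ℕ => x (n + ℓ - 1 + j)) inferInstance] T →
      μ S ≠ 0 →
      |(μ (S ∩ T)).toReal / (μ S).toReal - (μ T).toReal| ≤ ϕ ℓ

omit [Fintype A] [TopologicalSpace A] [DiscreteTopology A] [MeasurableSpace A] [BorelSpace A] in
lemma shift_prepend (a : A) (x : X A) : shift A (prepend A a x) = x := rfl

omit [Fintype A] [MeasurableSpace A] [BorelSpace A] in
lemma isClopen_of_dependsOn_Iio {G : Set (X A)} {m : ℕ}
    (hG : DependsOn (· ∈ G) (Iio m)) : IsClopen G := by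
  have : Finite (Iio m) := (finite_Iio m).to_subtype
  have hcont : Continuous fun (x : X A) (i : Iio m) => x i :=
    continuous_pi fun i => continuous_apply i.1
  let S : Set (Iio m → A) := {w | ∃ x ∈ G, ∀ i, w i = x i}
  convert (isClopen_discrete S).preimage hcont using 1
  ext x
  refine ⟨fun hx => ⟨x, hx, fun i => rfl⟩, fun ⟨y, hy, hxy⟩ => ?_⟩
  have : (x ∈ G) = (y ∈ G) := hG fun i hi => hxy ⟨i, hi⟩
  exact this ▸ hy

omit [DiscreteTopology A] [MeasurableSpace A] [BorelSpace A] in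
/-- A continuous `u` for which `u - u ∘ θ - log |A|` is normalized is constant. -/
lemma eq_of_normalized_coboundary [Nonempty A] {u : X A → ℝ} (huc : Continuous u)
    (hnorm : Normalized A fun x => u x - u (shift A x) - Real.log (Fintype.card A))
    (x y : X A) : u x = u y := by
  obtain ⟨z, -, hz⟩ := isCompact_univ.exists_isMaxOn (univ_nonempty (α := X A)) huc.continuousOn
  have hmax : ∀ y, u y ≤ u z := fun y => hz (mem_univ y)
  have hN : (0 : ℝ) < Fintype.card A := by exact_mod_cast Fintype.card_pos
  have hstep : ∀ (w : X A) (a : A), u w = u z → u (prepend A a w) = u z := by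
    intro w a hw
    have h := hnorm w
    simp only [shift_prepend, Real.exp_sub, Real.exp_log hN, hw, ← Finset.sum_div] at h
    rw [div_div, div_eq_one_iff_eq (by positivity)] at h
    have h' : ∑ b : A, Real.exp (u (prepend A b w)) = ∑ _b : A, Real.exp (u z) := by
      rw [h]; simp [mul_comm]
    have := (Finset.sum_eq_sum_iff_of_le
      (fun b _ => Real.exp_le_exp.2 (hmax (prepend A b w)))).1 h' a (Finset.mem_univ a)
    exact Real.exp_injective this
  have happrox : ∀ (n : ℕ) (y : X A), ∃ w, u w = u z ∧ ∀ i < n, w i = y i := by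
    intro n
    induction n with
    | zero => exact fun y => ⟨z, rfl, by simp⟩
    | succ n ih =>
      intro y
      obtain ⟨w, hw, hwy⟩ := ih (shift A y)
      refine ⟨prepend A (y 0) w, hstep w _ hw, fun i hi => ?_⟩
      cases i with
      | zero => rfl
      | succ i => exact hwy i (by omega)
  have hall : ∀ y, u y = u z := by
    intro y
    choose w hw hwy using fun n => happrox n y
    have hlim : Tendsto w atTop (𝓝 y) := by
      refine tendsto_pi_nhds.2 fun i => tendsto_const_nhds.congr' ?_
      filter_upwards [eventually_gt_atTop i] with n hn using (hwy n i hn).symm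
    refine tendsto_nhds_unique ((huc.tendsto y).comp hlim) ?_
    simp [Function.comp_def, hw]
  rw [hall x, hall y]

section UniformBernoulli

variable {A}

/-- The stationarity relation of the uniform Bernoulli measure on clopen sets. -/
lemma measureReal_eq_sum_prepend {μ : Measure (X A)}
    (hμ : IsEqSt A (fun _ => -Real.log (Fintype.card A)) μ) [Nonempty A]
    {G : Set (X A)} (hG : IsClopen G) :
    μ.real G = (Fintype.card A : ℝ)⁻¹ * ∑ a : A, μ.real (prepend A a ⁻¹' G) := by
  have := hμ.1
  have hN : (0 : ℝ) < Fintype.card A := by exact_mod_cast Fintype.card_pos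
  have hcont : ∀ a, Continuous (prepend A a) := by
    intro a
    refine continuous_pi fun i => ?_
    cases i with
    | zero => exact continuous_const
    | succ i => exact continuous_apply i
  have h := hμ.2 (G.indicator 1) (continuous_one.indicator (by simp [hG.frontier_eq]))
  rw [integral_indicator_one hG.isOpen.measurableSet] at h
  rw [← h]
  simp only [Real.exp_neg, Real.exp_log hN]
  simp_rw [← Finset.mul_sum]
  rw [integral_const_mul, integral_finsetSum]
  · congr 1
    refine Finset.sum_congr rfl fun a _ => ?_
    rw [← integral_indicator_one (hG.preimage (hcont a)).isOpen.measurableSet]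
    rfl
  · intro a _
    have : Integrable ((prepend A a ⁻¹' G).indicator (1 : X A → ℝ)) μ :=
      (integrable_const (1 : ℝ)).indicator (hG.preimage (hcont a)).isOpen.measurableSet
    exact this

lemma measureReal_inter_coord_eq {μ : Measure (X A)}
    (hμ : IsEqSt A (fun _ => -Real.log (Fintype.card A)) μ) [Nonempty A]
    (m : ℕ) {G : Set (X A)} (hG : DependsOn (· ∈ G) (Iio m)) {g : X A → A}
    (hg : DependsOn g (Iio m)) :
    μ.real (G ∩ {x | x m = g x}) = μ.real G / Fintype.card A := by
  classical
  have := hμ.1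
  have hN : (0 : ℝ) < Fintype.card A := by exact_mod_cast Fintype.card_pos
  have hclopen : IsClopen (G ∩ {x | x m = g x}) := by
    refine isClopen_of_dependsOn_Iio A (m := m + 1) fun x y hxy => ?_
    have h1 : (x ∈ G) = (y ∈ G) := hG fun i hi => hxy i (lt_trans hi (Nat.lt_succ_self m))
    have h2 : g x = g y := hg fun i hi => hxy i (lt_trans hi (Nat.lt_succ_self m))
    have h3 : x m = y m := hxy m (Nat.lt_succ_self m)
    simp only [mem_inter_iff, mem_ofPred_eq, h1, h2, h3]
  rw [measureReal_eq_sum_prepend hμ hclopen]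
  induction m generalizing G g with
  | zero =>
    obtain ⟨x₀⟩ : Nonempty (X A) := inferInstance
    have hgc : ∀ x, g x = g x₀ := fun x => hg (by simp)
    have hGc : ∀ x, (x ∈ G) = (x₀ ∈ G) := fun x => hG (by simp)
    have : ∀ a, prepend A a ⁻¹' (G ∩ {x | x 0 = g x}) = if a = g x₀ then G else ∅ := by
      intro a
      ext x
      have h0 : prepend A a x 0 = a := rfl
      simp only [mem_preimage, mem_inter_iff, mem_ofPred_eq, hgc, hGc (prepend A a x), h0]
      split_ifs with h <;> simp [h, hGc x]
    simp only [this, apply_ite, measureReal_empty]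
    simp [div_eq_inv_mul]
  | succ m ih =>
    have hdep : ∀ (a : A) {x y : X A}, (∀ i ∈ Iio m, x i = y i) →
        ∀ i ∈ Iio (m + 1), prepend A a x i = prepend A a y i := by
      intro a x y hxy i hi
      cases i with
      | zero => rfl
      | succ i => exact hxy i (Nat.lt_of_succ_lt_succ hi)
    have hGa : ∀ a, DependsOn (· ∈ prepend A a ⁻¹' G) (Iio m) :=
      fun a x y hxy => hG (hdep a hxy)
    have hga : ∀ a, DependsOn (g ∘ prepend A a) (Iio m) :=
      fun a x y hxy => hg (hdep a hxy)
    have hca : ∀ a, IsClopen (prepend A a ⁻¹' G ∩ {x | x m = (g ∘ prepend A a) x}) := by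
      intro a
      refine isClopen_of_dependsOn_Iio A (m := m + 1) fun x y hxy => ?_
      have h1 := hGa a fun i hi => hxy i (lt_trans hi (Nat.lt_succ_self m))
      have h2 := hga a fun i hi => hxy i (lt_trans hi (Nat.lt_succ_self m))
      have h3 : x m = y m := hxy m (Nat.lt_succ_self m)
      simp only at h1
      simp only [mem_inter_iff, mem_ofPred_eq, h1, h2, h3]
    have hsum : ∀ a, μ.real (prepend A a ⁻¹' (G ∩ {x | x (m + 1) = g x})) =
        μ.real (prepend A a ⁻¹' G) / Fintype.card A := by
      intro a
      rw [← ih (hGa a) (hga a) (hca a), ← measureReal_eq_sum_prepend hμ (hca a)]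
      rfl
    simp_rw [hsum]
    rw [← Finset.sum_div, measureReal_eq_sum_prepend hμ (isClopen_of_dependsOn_Iio A hG)]
    ring

/-- The set of points whose first `n` symbols reappear at position `k`. -/
def recurSet (A : Type*) (n k : ℕ) : Set (X A) := {x | ∀ i < n, x (k + i) = x i}

omit [Fintype A] [TopologicalSpace A] [DiscreteTopology A] [MeasurableSpace A] [BorelSpace A] in
lemma dependsOn_recurSet (n k : ℕ) : DependsOn (· ∈ recurSet A n k) (Iio (k + n)) := by
  intro x y hxy
  refine propext (forall₂_congr fun i hi => ?_)
  rw [hxy (k + i) (by simp [hi]), hxy i (mem_Iio.2 (by omega))]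

lemma measurableSet_recurSet (n k : ℕ) : MeasurableSet (recurSet A n k) :=
  (isClopen_of_dependsOn_Iio A (dependsOn_recurSet n k)).isOpen.measurableSet

lemma measureReal_inter_recurSet {μ : Measure (X A)}
    (hμ : IsEqSt A (fun _ => -Real.log (Fintype.card A)) μ) [Nonempty A]
    (n : ℕ) {m : ℕ} (hm : 1 ≤ m) {G : Set (X A)} (hG : DependsOn (· ∈ G) (Iio m)) :
    μ.real (G ∩ recurSet A n m) = μ.real G / (Fintype.card A : ℝ) ^ n := by
  induction n with
  | zero => simp [recurSet]
  | succ n ih =>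
    have hsplit : G ∩ recurSet A (n + 1) m =
        (G ∩ recurSet A n m) ∩ {x | x (m + n) = x n} := by
      ext x
      simp only [recurSet, mem_inter_iff, mem_ofPred_eq, Nat.forall_lt_succ_right, and_assoc]
    rw [hsplit, measureReal_inter_coord_eq hμ (m + n) (g := fun x => x n), ih, div_div, pow_succ]
    · intro x y hxy
      have h1 : (x ∈ G) = (y ∈ G) := hG fun i hi => hxy i (lt_of_lt_of_le hi (Nat.le_add_right m n))
      have h2 : (x ∈ recurSet A n m) = (y ∈ recurSet A n m) := dependsOn_recurSet n m hxy
      simp only [mem_inter_iff, h1, h2]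
    · exact fun x y hxy => hxy n (mem_Iio.2 (by omega))

lemma measureReal_recurSet {μ : Measure (X A)}
    (hμ : IsEqSt A (fun _ => -Real.log (Fintype.card A)) μ) [Nonempty A]
    (n : ℕ) {k : ℕ} (hk : 1 ≤ k) :
    μ.real (recurSet A n k) = ((Fintype.card A : ℝ) ^ n)⁻¹ := by
  have := hμ.1
  have h := measureReal_inter_recurSet hμ n hk (G := univ) (fun x y _ => by simp)
  simpa using h

/-- Exponential tail of the return time, obtained from disjoint blocks of length `n`. -/
lemma measureReal_forall_notMem_recurSet_le {μ : Measure (X A)}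
    (hμ : IsEqSt A (fun _ => -Real.log (Fintype.card A)) μ) [Nonempty A]
    {n : ℕ} (hn : 1 ≤ n) (l : ℕ) :
    μ.real {x | ∀ k, 1 ≤ k → k ≤ l * (n * Fintype.card A ^ n) → x ∉ recurSet A n k} ≤
      Real.exp (-l) := by
  have := hμ.1
  have hN : (0 : ℝ) < Fintype.card A := by exact_mod_cast Fintype.card_pos
  set p : ℝ := ((Fintype.card A : ℝ) ^ n)⁻¹ with hp
  have hblock : ∀ j : ℕ,
      μ.real {x | ∀ i < j, x ∉ recurSet A n ((i + 1) * n)} = (1 - p) ^ j := by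
    intro j
    induction j with
    | zero => simp
    | succ j ih =>
      have hsplit : {x | ∀ i < j + 1, x ∉ recurSet A n ((i + 1) * n)} =
          {x | ∀ i < j, x ∉ recurSet A n ((i + 1) * n)} \
            ({x | ∀ i < j, x ∉ recurSet A n ((i + 1) * n)} ∩ recurSet A n ((j + 1) * n)) := by
        ext x
        simp only [Nat.forall_lt_succ_right, mem_ofPred_eq, Set.mem_sdiff, mem_inter_iff]
        tauto
      have hdep : DependsOn (· ∈ {x : X A | ∀ i < j, x ∉ recurSet A n ((i + 1) * n)})
          (Iio ((j + 1) * n)) := by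
        intro x y hxy
        refine propext (forall₂_congr fun i hi => ?_)
        have : (x ∈ recurSet A n ((i + 1) * n)) = (y ∈ recurSet A n ((i + 1) * n)) :=
          dependsOn_recurSet n _ fun k hk => hxy k (Iio_subset_Iio (by
            have := Nat.mul_le_mul_right n (show i + 2 ≤ j + 1 by omega)
            linarith) hk)
        rw [this]
      have hmeas := (isClopen_of_dependsOn_Iio A hdep).isOpen.measurableSet
      rw [hsplit, measureReal_sdiff inter_subset_left
        (hmeas.inter (measurableSet_recurSet n _)),
        measureReal_inter_recurSet hμ n (by nlinarith) hdep, ih, pow_succ, div_eq_mul_inv]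
      ring
  have hp1 : p ≤ 1 := inv_le_one_of_one_le₀
    (one_le_pow₀ (by exact_mod_cast (Fintype.card_pos : 0 < Fintype.card A)))
  calc _ ≤ μ.real {x | ∀ i < l * Fintype.card A ^ n, x ∉ recurSet A n ((i + 1) * n)} := by
        refine measureReal_mono fun x hx i hi => hx _ (by nlinarith) ?_
        calc (i + 1) * n ≤ (l * Fintype.card A ^ n) * n := Nat.mul_le_mul_right _ hi
          _ = _ := by ring
    _ = (1 - p) ^ (l * Fintype.card A ^ n) := hblock _
    _ ≤ Real.exp (-p) ^ (l * Fintype.card A ^ n) :=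
        pow_le_pow_left₀ (by linarith) (Real.one_sub_le_exp_neg p) _
    _ = Real.exp (-l) := by
        rw [← Real.exp_nat_mul, hp]
        congr 1
        push_cast
        field_simp

end UniformBernoulli

section FirstReturn

variable {Ω : Type*}

/-- The return time attached to a sequence of events, `E k` being the event of a return
after `k` steps. -/
noncomputable def firstReturn (E : ℕ → Set Ω) (x : Ω) : ℕ := sInf {k | 2 ≤ k ∧ x ∈ E (k - 1)}

/-- The event that there is no return within the first `L` steps. -/
def noReturn (E : ℕ → Set Ω) (L : ℕ) : Set Ω := {x | ∀ k, 1 ≤ k → k ≤ L → x ∉ E k}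

lemma firstReturn_mem {E : ℕ → Set Ω} {x : Ω} {k : ℕ} (hk : 1 ≤ k) (hx : x ∈ E k) :
    2 ≤ firstReturn E x ∧ x ∈ E (firstReturn E x - 1) :=
  Nat.sInf_mem (s := {k | 2 ≤ k ∧ x ∈ E (k - 1)}) ⟨k + 1, by omega, hx⟩

lemma firstReturn_le {E : ℕ → Set Ω} {x : Ω} {k : ℕ} (hk : 1 ≤ k) (hx : x ∈ E k) :
    firstReturn E x ≤ k + 1 :=
  Nat.sInf_le ⟨by omega, hx⟩

lemma mem_noReturn_of_lt_firstReturn {E : ℕ → Set Ω} {x : Ω} {L : ℕ}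
    (h : L + 1 < firstReturn E x) : x ∈ noReturn E L := by
  intro k hk hkL hx
  have := firstReturn_le hk hx
  omega

variable [MeasurableSpace Ω] {μ : Measure Ω} [IsProbabilityMeasure μ] {E : ℕ → Set Ω}

omit [IsProbabilityMeasure μ] in
lemma measurableSet_noReturn (hE : ∀ k, MeasurableSet (E k)) (L : ℕ) :
    MeasurableSet (noReturn E L) := by
  have : noReturn E L = ⋂ k, ⋂ (_ : 1 ≤ k), ⋂ (_ : k ≤ L), (E k)ᶜ := by
    ext x; simp [noReturn]
  rw [this]
  exact .iInter fun k => .iInter fun _ => .iInter fun _ => (hE k).compl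

lemma ae_exists_return {B : ℕ} (htail : ∀ l : ℕ, μ.real (noReturn E (l * B)) ≤ Real.exp (-l)) :
    ∀ᵐ x ∂μ, ∃ k, 1 ≤ k ∧ x ∈ E k := by
  rw [ae_iff, ← measureReal_eq_zero_iff]
  refine le_antisymm (ge_of_tendsto' (f := fun l : ℕ => Real.exp (-l)) (x := atTop) ?_
    fun l => ?_) measureReal_nonneg
  · exact Real.tendsto_exp_neg_atTop_nhds_zero.comp tendsto_natCast_atTop_atTop
  · refine (measureReal_mono fun x hx => ?_).trans (htail l)
    exact fun k hk _ hxk => hx ⟨k, hk, hxk⟩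

/-- Lower bound of an integral by the contribution of an event. -/
lemma ofReal_mul_le_lintegral {f : Ω → ℝ} {S : Set Ω} (hS : MeasurableSet S) {c p : ℝ}
    (hc : 0 ≤ c) (hp : p ≤ μ.real S) (hf : ∀ᵐ x ∂μ, x ∈ S → c ≤ f x) :
    ENNReal.ofReal (c * p) ≤ ∫⁻ x, ENNReal.ofReal (f x) ∂μ := by
  calc ENNReal.ofReal (c * p) ≤ ENNReal.ofReal c * μ S := by
        rw [ENNReal.ofReal_mul hc, ← ofReal_measureReal]
        gcongr
    _ = ∫⁻ x, S.indicator (fun _ => ENNReal.ofReal c) x ∂μ := (lintegral_indicator_const hS _).symm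
    _ ≤ _ := by
        refine lintegral_mono_ae ?_
        filter_upwards [hf] with x hx
        by_cases h : x ∈ S
        · simpa [h] using ENNReal.ofReal_le_ofReal (hx h)
        · simp [h]

/-- Upper bound of an integral when almost every point lies in one of the events `S l` with
`f ≤ c l` there. -/
lemma lintegral_le_ofReal_tsum {f : Ω → ℝ} {S : ℕ → Set Ω} (hS : ∀ l, MeasurableSet (S l))
    {c p : ℕ → ℝ} (hc : ∀ l, 0 ≤ c l) (hp : ∀ l, μ.real (S l) ≤ p l)
    (hsum : Summable fun l => c l * p l) (hf : ∀ᵐ x ∂μ, ∃ l, x ∈ S l ∧ f x ≤ c l) :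
    ∫⁻ x, ENNReal.ofReal (f x) ∂μ ≤ ENNReal.ofReal (∑' l, c l * p l) := by
  calc ∫⁻ x, ENNReal.ofReal (f x) ∂μ
      ≤ ∫⁻ x, ∑' l, (S l).indicator (fun _ => ENNReal.ofReal (c l)) x ∂μ := by
        refine lintegral_mono_ae ?_
        filter_upwards [hf] with x ⟨l, hl, hx⟩
        refine le_trans ?_ (ENNReal.le_tsum l)
        simpa [hl] using ENNReal.ofReal_le_ofReal hx
    _ = ∑' l, ENNReal.ofReal (c l) * μ (S l) := by
        rw [lintegral_tsum fun l => (measurable_const.indicator (hS l)).aemeasurable]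
        exact tsum_congr fun l => lintegral_indicator_const (hS l) _
    _ ≤ ∑' l, ENNReal.ofReal (c l * p l) := by
        refine ENNReal.tsum_le_tsum fun l => ?_
        rw [ENNReal.ofReal_mul (hc l), ← ofReal_measureReal]
        gcongr
        exact hp l
    _ = _ := (ENNReal.ofReal_tsum_of_nonneg
        (fun l => mul_nonneg (hc l) (measureReal_nonneg.trans (hp l))) hsum).symm

lemma summable_rpow_mul_exp_neg (q : ℝ) :
    Summable fun l : ℕ => ((l : ℝ) + 1) ^ q * Real.exp (-l) := by
  have h := ((summable_nat_add_iff 1).2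
    (Real.summable_pow_mul_exp_neg_nat_mul ⌈q⌉₊ one_pos)).mul_left (Real.exp 1)
  refine h.of_nonneg_of_le (fun l => by positivity) fun l => ?_
  have h1 : ((l : ℝ) + 1) ^ q ≤ ((l : ℝ) + 1) ^ ⌈q⌉₊ := by
    rw [← Real.rpow_natCast]
    exact Real.rpow_le_rpow_of_exponent_le (by linarith [l.cast_nonneg (α := ℝ)]) (Nat.le_ceil q)
  have h2 : Real.exp 1 * Real.exp (-1 * ((l + 1 : ℕ) : ℝ)) = Real.exp (-l) := by
    rw [← Real.exp_add]; congr 1; push_cast; ring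
  calc ((l : ℝ) + 1) ^ q * Real.exp (-l) ≤ ((l : ℝ) + 1) ^ ⌈q⌉₊ * Real.exp (-l) := by gcongr
    _ = _ := by rw [← h2]; push_cast; ring

lemma lintegral_rpow_firstReturn_le_of_nonneg (hE : ∀ k, MeasurableSet (E k)) {B : ℕ}
    (hB : 1 ≤ B) (htail : ∀ l : ℕ, μ.real (noReturn E (l * B)) ≤ Real.exp (-l))
    {q : ℝ} (hq : 0 ≤ q) :
    ∫⁻ x, ENNReal.ofReal ((firstReturn E x : ℝ) ^ q) ∂μ ≤
      ENNReal.ofReal ((∑' l : ℕ, ((l : ℝ) + 1) ^ q * Real.exp (-l)) * (2 * B) ^ q) := by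
  have heq : ∀ l : ℕ, ((l : ℝ) + 1) ^ q * Real.exp (-l) * (2 * B) ^ q =
      (((l : ℝ) + 1) * (2 * B)) ^ q * Real.exp (-l) := by
    intro l
    rw [Real.mul_rpow (x := (l : ℝ) + 1) (by positivity) (by positivity)]; ring
  rw [← tsum_mul_right]
  simp_rw [heq]
  refine lintegral_le_ofReal_tsum (fun l => measurableSet_noReturn hE (l * B))
    (fun l => by positivity) htail ?_ ?_
  · simp_rw [← heq]
    exact (summable_rpow_mul_exp_neg q).mul_right _
  · filter_upwards [ae_exists_return htail] with x ⟨k, hk, hx⟩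
    have h2 := (firstReturn_mem hk hx).1
    refine ⟨(firstReturn E x - 2) / B, mem_noReturn_of_lt_firstReturn ?_, ?_⟩
    · have := Nat.div_mul_le_self (firstReturn E x - 2) B
      omega
    · refine Real.rpow_le_rpow (by positivity) ?_ hq
      have h3 := Nat.lt_div_mul_add (a := firstReturn E x - 2) (b := B) (by omega)
      have h4 : firstReturn E x ≤ ((firstReturn E x - 2) / B + 1) * (2 * B) := by
        generalize (firstReturn E x - 2) / B = d at *
        have : firstReturn E x ≤ d * B + B + 1 := by omega
        nlinarith
      exact_mod_cast h4

lemma lintegral_rpow_firstReturn_le_of_lt_neg_one (hE : ∀ k, MeasurableSet (E k)) {M B : ℕ}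
    (hM : ∀ k, 1 ≤ k → μ.real (E k) = (M : ℝ)⁻¹)
    (htail : ∀ l : ℕ, μ.real (noReturn E (l * B)) ≤ Real.exp (-l))
    {q : ℝ} (hq : q < -1) :
    ∫⁻ x, ENNReal.ofReal ((firstReturn E x : ℝ) ^ q) ∂μ ≤
      ENNReal.ofReal ((∑' k : ℕ, ((k + 2 : ℕ) : ℝ) ^ q) * (M : ℝ)⁻¹) := by
  rw [← tsum_mul_right]
  refine lintegral_le_ofReal_tsum (fun k => hE (k + 1)) (fun k => by positivity)
    (fun k => (hM (k + 1) (by omega)).le) ?_ ?_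
  · exact ((summable_nat_add_iff 2).2 (Real.summable_nat_rpow.2 hq)).mul_right _
  · filter_upwards [ae_exists_return htail] with x ⟨k, hk, hx⟩
    obtain ⟨h2, h3⟩ := firstReturn_mem hk hx
    refine ⟨firstReturn E x - 2, ?_, ?_⟩
    · rwa [show firstReturn E x - 2 + 1 = firstReturn E x - 1 by omega]
    · rw [Nat.sub_add_cancel h2]

lemma sum_rpow_le {q : ℝ} (hq : -1 ≤ q) (M : ℕ) :
    ∑ k ∈ Finset.Icc 1 M, (k : ℝ) ^ q ≤ (M : ℝ) ^ (q + 1) * (1 + Real.log M) := by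
  calc ∑ k ∈ Finset.Icc 1 M, (k : ℝ) ^ q
      ≤ ∑ k ∈ Finset.Icc 1 M, (M : ℝ) ^ (q + 1) * (k : ℝ)⁻¹ := by
        refine Finset.sum_le_sum fun k hk => ?_
        obtain ⟨hk1, hkM⟩ := Finset.mem_Icc.1 hk
        have hk0 : (0 : ℝ) < k := by exact_mod_cast hk1
        have h : (k : ℝ) ^ q = (k : ℝ) ^ (q + 1) * (k : ℝ)⁻¹ := by
          rw [Real.rpow_add_one hk0.ne', mul_assoc, mul_inv_cancel₀ hk0.ne', mul_one]
        rw [h]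
        gcongr
        linarith
    _ = (M : ℝ) ^ (q + 1) * (harmonic M : ℝ) := by
        rw [← Finset.mul_sum, harmonic_eq_sum_Icc]; push_cast; rfl
    _ ≤ _ := by gcongr; exact harmonic_le_one_add_log M

lemma lintegral_rpow_firstReturn_le_of_neg (hE : ∀ k, MeasurableSet (E k)) {M B : ℕ}
    (hM1 : 1 ≤ M) (hM : ∀ k, 1 ≤ k → μ.real (E k) = (M : ℝ)⁻¹)
    (htail : ∀ l : ℕ, μ.real (noReturn E (l * B)) ≤ Real.exp (-l))
    {q : ℝ} (hq : -1 ≤ q) (hq0 : q < 0) :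
    ∫⁻ x, ENNReal.ofReal ((firstReturn E x : ℝ) ^ q) ∂μ ≤
      ENNReal.ofReal ((2 + Real.log M) * (M : ℝ) ^ q) := by
  have hM0 : (0 : ℝ) < M := by exact_mod_cast hM1
  let S : ℕ → Set Ω := fun k => if k = 0 then univ else if k ≤ M then E k else ∅
  let c : ℕ → ℝ := fun k => if k = 0 then (M : ℝ) ^ q else if k ≤ M then (k : ℝ) ^ q else 0
  let p : ℕ → ℝ := fun k => if k = 0 then 1 else if k ≤ M then (M : ℝ)⁻¹ else 0
  have hzero : ∀ k ∉ Finset.range (M + 1), c k * p k = 0 := by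
    intro k hk
    have : M < k := by simpa [Nat.lt_succ_iff] using hk
    simp [c, show k ≠ 0 by omega, show ¬ k ≤ M by omega]
  have hsum : ∑' k, c k * p k ≤ (2 + Real.log M) * (M : ℝ) ^ q := by
    rw [tsum_eq_sum hzero, Finset.range_eq_Ico, Finset.sum_eq_sum_Ico_succ_bot (by omega)]
    have h1 : ∑ k ∈ Finset.Ico (0 + 1) (M + 1), c k * p k =
        (∑ k ∈ Finset.Icc 1 M, (k : ℝ) ^ q) * (M : ℝ)⁻¹ := by
      rw [Finset.sum_mul]
      refine Finset.sum_congr (by ext; simp) fun k hk => ?_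
      obtain ⟨hk1, hkM⟩ := Finset.mem_Icc.1 hk
      simp [c, p, show k ≠ 0 by omega, hkM]
    rw [h1]
    have h2 : (M : ℝ) ^ (q + 1) * (M : ℝ)⁻¹ = (M : ℝ) ^ q := by
      rw [Real.rpow_add_one hM0.ne', mul_assoc, mul_inv_cancel₀ hM0.ne', mul_one]
    calc c 0 * p 0 + (∑ k ∈ Finset.Icc 1 M, (k : ℝ) ^ q) * (M : ℝ)⁻¹
        ≤ (M : ℝ) ^ q + (M : ℝ) ^ (q + 1) * (1 + Real.log M) * (M : ℝ)⁻¹ := by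
          gcongr
          · simp [c, p]
          · exact sum_rpow_le hq M
      _ = (M : ℝ) ^ q + (1 + Real.log M) * ((M : ℝ) ^ (q + 1) * (M : ℝ)⁻¹) := by ring
      _ = _ := by rw [h2]; ring
  refine (lintegral_le_ofReal_tsum (S := S) (c := c) (p := p) ?_ ?_ ?_
    (summable_of_ne_finset_zero hzero) ?_).trans (ENNReal.ofReal_le_ofReal hsum)
  · intro k
    simp only [S]
    split_ifs
    exacts [.univ, hE k, .empty]
  · intro k
    simp only [c]
    split_ifs <;> positivity
  · intro k
    simp only [S, p]
    split_ifs with h1 h2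
    · simp
    · exact (hM k (by omega)).le
    · simp
  · filter_upwards [ae_exists_return htail] with x ⟨k, hk, hx⟩
    obtain ⟨h2, h3⟩ := firstReturn_mem hk hx
    by_cases h : firstReturn E x - 1 ≤ M
    · refine ⟨firstReturn E x - 1, ?_, ?_⟩
      · simpa [S, show firstReturn E x - 1 ≠ 0 by omega, h] using h3
      · simp only [c, show firstReturn E x - 1 ≠ 0 by omega, h, if_true, if_false]
        refine Real.rpow_le_rpow_of_nonpos ?_ ?_ hq0.le
        · exact_mod_cast (by omega : 0 < firstReturn E x - 1)
        · exact_mod_cast Nat.sub_le _ _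
    · refine ⟨0, by simp [S], ?_⟩
      simp only [c, if_true]
      refine Real.rpow_le_rpow_of_nonpos hM0 ?_ hq0.le
      exact_mod_cast (by omega : M ≤ firstReturn E x)

lemma le_lintegral_rpow_firstReturn_of_nonneg (hE : ∀ k, MeasurableSet (E k)) {M B : ℕ}
    (hM1 : 1 ≤ M) (hM : ∀ k, 1 ≤ k → μ.real (E k) = (M : ℝ)⁻¹)
    (htail : ∀ l : ℕ, μ.real (noReturn E (l * B)) ≤ Real.exp (-l))
    {q : ℝ} (hq : 0 ≤ q) :
    ENNReal.ofReal (((M : ℝ) / 2) ^ q * (1 / 2)) ≤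
      ∫⁻ x, ENNReal.ofReal ((firstReturn E x : ℝ) ^ q) ∂μ := by
  have hM0 : (0 : ℝ) < M := by exact_mod_cast hM1
  have hcompl : (noReturn E (M / 2))ᶜ ⊆ ⋃ k ∈ Finset.Icc 1 (M / 2), E k := by
    intro x hx
    simp only [noReturn, mem_compl_iff, mem_ofPred_eq, not_forall, not_not] at hx
    obtain ⟨k, hk, hkL, hxk⟩ := hx
    exact mem_biUnion (Finset.mem_coe.2 (Finset.mem_Icc.2 ⟨hk, hkL⟩)) hxk
  have hle : μ.real (noReturn E (M / 2))ᶜ ≤ 1 / 2 := by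
    calc _ ≤ ∑ k ∈ Finset.Icc 1 (M / 2), μ.real (E k) :=
          (measureReal_mono hcompl (measure_ne_top _ _)).trans (measureReal_biUnion_finset_le _ _)
      _ = ((M / 2 : ℕ) : ℝ) * (M : ℝ)⁻¹ := by
          rw [Finset.sum_congr rfl fun k hk => hM k (Finset.mem_Icc.1 hk).1]
          simp
      _ ≤ ((M : ℝ) / 2) * (M : ℝ)⁻¹ := by gcongr; exact_mod_cast Nat.cast_div_le
      _ = 1 / 2 := by field_simp
  have hmeas := measurableSet_noReturn hE (M / 2)
  refine ofReal_mul_le_lintegral hmeas (by positivity) (p := 1 / 2) ?_ ?_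
  · rw [probReal_compl_eq_one_sub hmeas] at hle
    linarith
  · filter_upwards [ae_exists_return htail] with x ⟨k, hk, hx⟩ hxS
    obtain ⟨h2, h3⟩ := firstReturn_mem hk hx
    refine Real.rpow_le_rpow (by positivity) ?_ hq
    have h4 : M / 2 < firstReturn E x - 1 := by
      by_contra! hcon
      exact hxS _ (by omega) hcon h3
    have h5 : M ≤ 2 * firstReturn E x := by omega
    have h6 : (M : ℝ) ≤ 2 * firstReturn E x := by exact_mod_cast h5
    linarith

lemma le_lintegral_rpow_firstReturn_of_nonpos (hE : ∀ k, MeasurableSet (E k)) {B : ℕ}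
    (hB : 1 ≤ B) (htail : ∀ l : ℕ, μ.real (noReturn E (l * B)) ≤ Real.exp (-l))
    {q : ℝ} (hq : q ≤ 0) :
    ENNReal.ofReal ((2 * (B : ℝ)) ^ q * (1 - Real.exp (-1))) ≤
      ∫⁻ x, ENNReal.ofReal ((firstReturn E x : ℝ) ^ q) ∂μ := by
  have hmeas := measurableSet_noReturn hE B
  refine ofReal_mul_le_lintegral hmeas.compl (by positivity) ?_ (.of_forall fun x hx => ?_)
  · rw [probReal_compl_eq_one_sub hmeas]
    have := htail 1
    simp only [one_mul, Nat.cast_one] at this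
    linarith
  · simp only [noReturn, mem_compl_iff, mem_ofPred_eq, not_forall, not_not] at hx
    obtain ⟨k, hk, hkB, hxk⟩ := hx
    have h1 := (firstReturn_mem hk hxk).1
    have h2 := firstReturn_le hk hxk
    refine Real.rpow_le_rpow_of_nonpos ?_ ?_ hq
    · exact_mod_cast (by omega : 0 < firstReturn E x)
    · exact_mod_cast (by omega : firstReturn E x ≤ 2 * B)

lemma le_lintegral_rpow_firstReturn (hE : ∀ k, MeasurableSet (E k)) {M : ℕ}
    (hM : ∀ k, 1 ≤ k → μ.real (E k) = (M : ℝ)⁻¹) (q : ℝ) :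
    ENNReal.ofReal ((2 : ℝ) ^ q * (M : ℝ)⁻¹) ≤
      ∫⁻ x, ENNReal.ofReal ((firstReturn E x : ℝ) ^ q) ∂μ := by
  refine ofReal_mul_le_lintegral (hE 1) (by positivity) (hM 1 le_rfl).ge
    (.of_forall fun x hx => ?_)
  have h1 := (firstReturn_mem le_rfl hx).1
  have h2 := firstReturn_le le_rfl hx
  rw [show firstReturn E x = 2 by omega, Nat.cast_ofNat]

end FirstReturn

/-- Two-sided bounds of the form `c * n ^ a * (N ^ n) ^ s` determine the growth rate. -/
lemma tendsto_inv_mul_log_of_bounds {N s a b c C : ℝ} (hN : 0 < N) (hc : 0 < c) (hC : 0 < C)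
    {Z : ℕ → ENNReal}
    (hl : ∀ n : ℕ, 1 ≤ n → ENNReal.ofReal (c * (n : ℝ) ^ a * (N ^ n) ^ s) ≤ Z n)
    (hu : ∀ n : ℕ, 1 ≤ n → Z n ≤ ENNReal.ofReal (C * (n : ℝ) ^ b * (N ^ n) ^ s)) :
    Tendsto (fun n : ℕ => (((n : ℝ)⁻¹ : ℝ) : EReal) * ENNReal.log (Z n)) atTop
      (𝓝 ((s * Real.log N : ℝ) : EReal)) := by
  have hpos : ∀ {d e : ℝ}, 0 < d → ∀ n : ℕ, 1 ≤ n → 0 < d * (n : ℝ) ^ e * (N ^ n) ^ s := by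
    intro d e hd n hn
    have : (0 : ℝ) < n := by exact_mod_cast hn
    positivity
  have hlim : ∀ {d : ℝ} (e : ℝ), 0 < d → Tendsto (fun n : ℕ =>
      (((n : ℝ)⁻¹ : ℝ) : EReal) * ENNReal.log (ENNReal.ofReal (d * (n : ℝ) ^ e * (N ^ n) ^ s)))
      atTop (𝓝 ((s * Real.log N : ℝ) : EReal)) := by
    intro d e hd
    have hinv : Tendsto (fun n : ℕ => (n : ℝ)⁻¹) atTop (𝓝 0) :=
      tendsto_inv_atTop_zero.comp tendsto_natCast_atTop_atTop
    have hlog : Tendsto (fun n : ℕ => Real.log n / n) atTop (𝓝 0) :=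
      Real.isLittleO_log_id_atTop.tendsto_div_nhds_zero.comp tendsto_natCast_atTop_atTop
    have hreal : Tendsto (fun n : ℕ => (n : ℝ)⁻¹ * Real.log d + e * (Real.log n / n) +
        s * Real.log N) atTop (𝓝 (s * Real.log N)) := by
      simpa using ((hinv.mul_const (Real.log d)).add (hlog.const_mul e)).add_const (s * Real.log N)
    refine ((continuous_coe_real_ereal.tendsto _).comp hreal).congr' ?_
    filter_upwards [eventually_ge_atTop 1] with n hn
    have hn0 : (0 : ℝ) < n := by exact_mod_cast hn
    rw [ENNReal.log_ofReal_of_pos (hpos hd n hn), ← EReal.coe_mul, Function.comp_apply,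
      Real.log_mul (by positivity) (by positivity), Real.log_mul (by positivity) (by positivity),
      Real.log_rpow hn0, Real.log_rpow (by positivity), Real.log_pow]
    congr 1
    field_simp
  refine tendsto_of_tendsto_of_tendsto_of_le_of_le' (hlim a hc) (hlim b hC) ?_ ?_
  · filter_upwards [eventually_ge_atTop 1] with n hn
    exact mul_le_mul_of_nonneg_left (ENNReal.log_le_log (hl n hn))
      (EReal.coe_nonneg.2 (by positivity))
  · filter_upwards [eventually_ge_atTop 1] with n hn
    exact mul_le_mul_of_nonneg_left (ENNReal.log_le_log (hu n hn))
      (EReal.coe_nonneg.2 (by positivity))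

/-- for a normalized potential `φ = u - u∘θ - log|A|` with summable
variation (so `μ_φ` is the measure of maximal entropy), the return-time
`L^q`-spectrum exists and equals `q log|A|` for `q ≥ -1` and `-log|A|` for `q < -1`. -/
theorem return_time_spectrum_max_entropy
    (hcard : 1 < Fintype.card A)
    (φ : X A → ℝ) (hφc : Continuous φ)
    (hvar : Summable (fun n => Var A φ (n + 1)))
    (hnorm : Normalized A φ)
    (μφ : Measure (X A)) (hμ : IsEqSt A φ μφ)
    (u : X A → ℝ) (huc : Continuous u)
    (hφu : ∀ x, φ x = u x - u (shift A x) - Real.log (Fintype.card A)) :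
    ∀ q : ℝ,
      (-1 ≤ q → Tendsto (RSeq A μφ q) atTop
        (nhds ((q * Real.log (Fintype.card A) : ℝ) : EReal))) ∧
      (q < -1 → Tendsto (RSeq A μφ q) atTop
        (nhds ((-Real.log (Fintype.card A) : ℝ) : EReal))) := by
  intro q
  have := hμ.1
  have : Nonempty A := Fintype.card_pos_iff.1 (by omega)
  have hconst : φ = fun _ => -Real.log (Fintype.card A) := by
    have hφ' : φ = fun x => u x - u (shift A x) - Real.log (Fintype.card A) := funext hφu
    funext x
    rw [hφu, eq_of_normalized_coboundary A huc (hφ' ▸ hnorm) x (shift A x)]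
    ring
  rw [hconst] at hμ
  set N : ℝ := (Fintype.card A : ℝ) with hNdef
  have hN : 1 < N := Nat.one_lt_cast.2 hcard
  have hN0 : 0 < N := by linarith
  have hE : ∀ n k, MeasurableSet (recurSet A n k) := measurableSet_recurSet
  have hcast : ∀ n : ℕ, ((Fintype.card A ^ n : ℕ) : ℝ) = N ^ n := by simp [hNdef]
  have hM : ∀ n k, 1 ≤ k → μφ.real (recurSet A n k) = ((Fintype.card A ^ n : ℕ) : ℝ)⁻¹ := by
    intro n k hk
    rw [hcast, measureReal_recurSet hμ n hk]
  have hM1 : ∀ n, 1 ≤ Fintype.card A ^ n := fun n => Nat.one_le_pow _ _ (by omega)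
  have hB : ∀ n, 1 ≤ n → 1 ≤ n * Fintype.card A ^ n :=
    fun n hn => Nat.one_le_iff_ne_zero.2 (mul_ne_zero (by omega) (by have := hM1 n; omega))
  have htail : ∀ n, 1 ≤ n → ∀ l : ℕ,
      μφ.real (noReturn (recurSet A n) (l * (n * Fintype.card A ^ n))) ≤ Real.exp (-l) :=
    fun n hn l => measureReal_forall_notMem_recurSet_le hμ hn l
  have hfactor : ∀ n : ℕ, (2 * ((n * Fintype.card A ^ n : ℕ) : ℝ)) ^ q =
      2 ^ q * (n : ℝ) ^ q * (N ^ n) ^ q := by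
    intro n
    rw [Nat.cast_mul, hcast, Real.mul_rpow (by positivity) (by positivity),
      Real.mul_rpow (by positivity) (by positivity), mul_assoc]
  constructor
  · intro hq
    rcases le_or_gt 0 q with hq0 | hq0
    · refine tendsto_inv_mul_log_of_bounds (c := 2⁻¹ ^ q * (1 / 2)) (a := 0)
        (C := (∑' l : ℕ, ((l : ℝ) + 1) ^ q * Real.exp (-l)) * 2 ^ q) (b := q) hN0
        (by positivity) ?_ (fun n hn => ?_) (fun n hn => ?_)
      · have := (summable_rpow_mul_exp_neg q).tsum_pos (fun l => by positivity) 0 (by simp)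
        positivity
      · refine (ENNReal.ofReal_le_ofReal (le_of_eq ?_)).trans
          (le_lintegral_rpow_firstReturn_of_nonneg (hE n) (hM1 n) (hM n) (htail n hn) hq0)
        rw [hcast, div_eq_mul_inv (N ^ n), Real.mul_rpow (x := N ^ n) (by positivity) (by positivity),
          Real.rpow_zero]
        ring
      · refine (lintegral_rpow_firstReturn_le_of_nonneg (hE n) (hB n hn) (htail n hn) hq0).trans
          (ENNReal.ofReal_le_ofReal (le_of_eq ?_))
        rw [hfactor]
        ring
    · have hlogN : 0 < Real.log N := Real.log_pos hN
      refine tendsto_inv_mul_log_of_bounds (c := 2 ^ q * (1 - Real.exp (-1))) (a := q)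
        (C := 2 + Real.log N) (b := 1) hN0 ?_ (by positivity) (fun n hn => ?_) (fun n hn => ?_)
      · have : Real.exp (-1) < 1 := by simp
        exact mul_pos (by positivity) (by linarith)
      · refine (ENNReal.ofReal_le_ofReal (le_of_eq ?_)).trans
          (le_lintegral_rpow_firstReturn_of_nonpos (hE n) (hB n hn) (htail n hn) hq0.le)
        rw [hfactor]
        ring
      · refine (lintegral_rpow_firstReturn_le_of_neg (hE n) (hM1 n) (hM n) (htail n hn) hq
          hq0).trans (ENNReal.ofReal_le_ofReal ?_)
        have hn1 : (1 : ℝ) ≤ n := by exact_mod_cast hn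
        rw [hcast, Real.log_pow, Real.rpow_one]
        gcongr
        nlinarith
  · intro hq
    rw [neg_eq_neg_one_mul]
    refine tendsto_inv_mul_log_of_bounds (c := 2 ^ q) (a := 0)
      (C := ∑' k : ℕ, ((k + 2 : ℕ) : ℝ) ^ q) (b := 0) hN0 (by positivity) ?_
      (fun n hn => ?_) (fun n hn => ?_)
    · exact ((summable_nat_add_iff 2).2 (Real.summable_nat_rpow.2 hq)).tsum_pos
        (fun k => by positivity) 0 (by positivity)
    · refine (ENNReal.ofReal_le_ofReal (le_of_eq ?_)).trans
          (le_lintegral_rpow_firstReturn (hE n) (hM n) q)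
      rw [hcast, Real.rpow_zero, mul_one, Real.rpow_neg_one]
    · refine (lintegral_rpow_firstReturn_le_of_lt_neg_one (hE n) (hM n) (htail n hn) hq).trans
          (ENNReal.ofReal_le_ofReal (le_of_eq ?_))
      rw [hcast, Real.rpow_zero, mul_one, Real.rpow_neg_one]

end RTSpec
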